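/- Let B ∈ ℝ₊^{m₁×⋯×m_d} (d ≥ 2, each m_j ≥ 2) be a nonnegative tensor with no zero slice, and let s_k ∈ ℝ^{m_k}, k ∈ [d], be positive vectors. Then there exists a nonnegative tensor C ∈ ℝ₊^{m₁×⋯×m_d} that is positively diagonally equivalent to B and has every (k,i_k)-slice sum equal to s_{k,i_k}, if and only if there exists a nonnegative tensor A ∈ ℝ₊^{m₁×⋯×m_d} having the same zero pattern as B (a_{i₁,…,i_d} = 0 ⟺ b_{i₁,…,i_d} = 0) whose (k,i_k)-slice sums equal s_{k,i_k} for all k ∈ [d], i_k ∈ [m_k]. -/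

import Mathlib

open Filter Topology

/-- For `a, b > 0`, the function `t ↦ b * exp t - a * t` is coercive. -/
theorem tendsto_mul_exp_sub_mul_cocompact {a b : ℝ} (ha : 0 < a) (hb : 0 < b) :
    Tendsto (fun t : ℝ => b * Real.exp t - a * t) (cocompact ℝ) atTop := by
  rw [cocompact_eq_atBot_atTop, tendsto_sup]
  constructor
  · refine tendsto_atTop_mono (f := fun t => -a * t) (fun t => ?_)
      (tendsto_id.const_mul_atBot_of_neg (neg_neg_of_pos ha))
    have := mul_pos hb (Real.exp_pos t)
    linarith
  · have hlim : Tendsto (fun t : ℝ => a * t + 2 * a * (1 - Real.log (2 * a / b))) atTop atTop :=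
      tendsto_atTop_add_const_right _ _ (tendsto_id.const_mul_atTop ha)
    refine tendsto_atTop_mono (fun t => ?_) hlim
    have hc : 0 < 2 * a / b := by positivity
    have h := Real.add_one_le_exp (t - Real.log (2 * a / b))
    rw [Real.exp_sub, Real.exp_log hc, le_div_iff₀ hc] at h
    have h' := mul_le_mul_of_nonneg_left h hb.le
    have hba : b * (2 * a / b) = 2 * a := by field_simp
    have heq : b * ((t - Real.log (2 * a / b) + 1) * (2 * a / b)) =
        (t - Real.log (2 * a / b) + 1) * (2 * a) := by
      rw [mul_left_comm, hba]
    rw [heq] at h'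
    linarith

/-- A finite separable sum of continuous coercive functions is coercive. -/
theorem tendsto_sum_apply_cocompact_atTop {ι : Type*} [Fintype ι] {g : ι → ℝ → ℝ}
    (hg : ∀ i, Continuous (g i)) (hlim : ∀ i, Tendsto (g i) (cocompact ℝ) atTop) :
    Tendsto (fun y : ι → ℝ => ∑ i, g i (y i)) (cocompact (ι → ℝ)) atTop := by
  classical
  have hbdd : ∀ i, ∃ t, ∀ u, g i t ≤ g i u := fun i => (hg i).exists_forall_le (hlim i)
  choose t ht using hbdd
  rw [← coprodᵢ_cocompact, Filter.coprodᵢ, tendsto_iSup]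
  intro i
  refine tendsto_atTop_mono (fun y => ?_)
    (tendsto_atTop_add_const_right _ (∑ j ∈ Finset.univ.erase i, g j (t j))
      ((hlim i).comp tendsto_comap))
  rw [← Finset.add_sum_erase _ _ (Finset.mem_univ i)]
  exact add_le_add_right (Finset.sum_le_sum fun j _ => ht j (y j)) _

/-- For positive weights `a, b`, some positive rescaling `b i * exp (L x i)` of `b` has the same
pairing with the range of the linear map `L` as `a`. -/
theorem exists_sum_mul_exp_eq_of_pos {ι V : Type*} [Fintype ι] [AddCommGroup V] [Module ℝ V]
    (L : V →ₗ[ℝ] (ι → ℝ)) {a b : ι → ℝ} (ha : ∀ i, 0 < a i) (hb : ∀ i, 0 < b i) :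
    ∃ x, ∀ v, ∑ i, b i * Real.exp (L x i) * L v i = ∑ i, a i * L v i := by
  set G : (ι → ℝ) → ℝ := fun y => ∑ i, (b i * Real.exp (y i) - a i * y i) with hG
  have hcoer : Tendsto G (cocompact (ι → ℝ)) atTop :=
    tendsto_sum_apply_cocompact_atTop (g := fun i t => b i * Real.exp t - a i * t)
      (fun i => by fun_prop) (fun i => tendsto_mul_exp_sub_mul_cocompact (ha i) (hb i))
  have hcont : Continuous G := by fun_prop
  obtain ⟨_, ⟨x, rfl⟩, hmin⟩ := hcont.continuousOn.exists_isMinOn'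
    (LinearMap.range L).closed_of_finiteDimensional (LinearMap.range L).zero_mem
    ((hcoer.eventually_ge_atTop (G 0)).filter_mono inf_le_left)
  refine ⟨x, fun v => ?_⟩
  have hderiv : HasDerivAt (fun r : ℝ => G (L x + r • L v))
      (∑ i, (b i * Real.exp (L x i) * L v i - a i * L v i)) 0 := by
    simp only [hG]
    refine HasDerivAt.fun_sum fun i _ => ?_
    have hline : HasDerivAt (fun r : ℝ => (L x + r • L v) i) (L v i) 0 := by
      simpa using ((hasDerivAt_id (0 : ℝ)).mul_const (L v i)).const_add (L x i)
    simpa [mul_assoc] using (hline.exp.const_mul (b i)).fun_sub (hline.const_mul (a i))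
  have hlocal : IsLocalMin (fun r : ℝ => G (L x + r • L v)) 0 :=
    Eventually.of_forall fun r => by
      have := hmin (show L x + r • L v ∈ (LinearMap.range L : Set (ι → ℝ)) from
        ⟨x + r • v, by simp⟩)
      simpa using this
  have hzero := hlocal.hasDerivAt_eq_zero hderiv
  rw [Finset.sum_sub_distrib] at hzero
  exact sub_eq_zero.mp hzero

/-- The version of `exists_sum_mul_exp_eq_of_pos` for nonnegative weights with equal supports. -/
theorem exists_sum_mul_exp_eq_of_nonneg {ι V : Type*} [Fintype ι] [AddCommGroup V] [Module ℝ V]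
    (L : V →ₗ[ℝ] (ι → ℝ)) {a b : ι → ℝ} (ha : ∀ i, 0 ≤ a i) (hb : ∀ i, 0 ≤ b i)
    (hab : ∀ i, a i = 0 ↔ b i = 0) :
    ∃ x, ∀ v, ∑ i, b i * Real.exp (L x i) * L v i = ∑ i, a i * L v i := by
  classical
  have hsum : ∀ f : ι → ℝ, (∀ i, b i = 0 → f i = 0) →
      ∑ i : {i // b i ≠ 0}, f i = ∑ i, f i := fun f hf => by
    rw [← Finset.sum_subtype (Finset.univ.filter fun i => b i ≠ 0) (by simp) f]
    refine Finset.sum_filter_of_ne fun i _ hi hbi => hi (hf i hbi)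
  obtain ⟨x, hx⟩ := exists_sum_mul_exp_eq_of_pos
    ((LinearMap.funLeft ℝ ℝ (Subtype.val : {i // b i ≠ 0} → ι)).comp L)
    (a := fun i => a i) (b := fun i => b i)
    (fun i => (ha i).lt_of_ne' fun h => i.2 ((hab i).mp h))
    (fun i => (hb i).lt_of_ne' i.2)
  refine ⟨x, fun v => ?_⟩
  rw [← hsum _ fun i hi => by simp [hi], ← hsum _ fun i hi => by simp [(hab i).mpr hi]]
  exact hx v


/-- Corollary 3.2 of the paper, tensor version of Menon's theorem.
A nonnegative tensor `B` with no zero slice admits a positively diagonally equivalent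
tensor with prescribed positive slice sums `s` if and only if there exists a nonnegative
tensor with the same zero pattern as `B` with these slice sums. -/
theorem tensor_scaling_iff_zero_pattern {d : ℕ} (hd : 2 ≤ d) {m : Fin d → ℕ}
    (hm : ∀ j, 2 ≤ m j)
    (B : ((j : Fin d) → Fin (m j)) → ℝ)
    (hB : ∀ i, 0 ≤ B i)
    (hslice : ∀ (k : Fin d) (ik : Fin (m k)),
      ∃ i : (j : Fin d) → Fin (m j), i k = ik ∧ B i ≠ 0)
    (s : (k : Fin d) → Fin (m k) → ℝ) (hs : ∀ k i, 0 < s k i) :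
    (∃ C : ((j : Fin d) → Fin (m j)) → ℝ, (∀ i, 0 ≤ C i) ∧
      (∃ x : (k : Fin d) → Fin (m k) → ℝ, ∀ i, C i = Real.exp (∑ k, x k (i k)) * B i) ∧
      (∀ (k : Fin d) (ik : Fin (m k)),
        ∑ i ∈ Finset.univ.filter (fun i : (j : Fin d) → Fin (m j) => i k = ik), C i
          = s k ik)) ↔
    (∃ A : ((j : Fin d) → Fin (m j)) → ℝ, (∀ i, 0 ≤ A i) ∧
      (∀ i : (j : Fin d) → Fin (m j), A i = 0 ↔ B i = 0) ∧
      (∀ (k : Fin d) (ik : Fin (m k)),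
        ∑ i ∈ Finset.univ.filter (fun i : (j : Fin d) → Fin (m j) => i k = ik), A i
          = s k ik)) := by
  constructor
  · rintro ⟨C, hC, ⟨x, hx⟩, hsum⟩
    exact ⟨C, hC, fun i => by simp [hx, Real.exp_ne_zero], hsum⟩
  · rintro ⟨A, hA, hAB, hsum⟩
    let L : ((k : Fin d) → Fin (m k) → ℝ) →ₗ[ℝ] (((j : Fin d) → Fin (m j)) → ℝ) :=
      { toFun := fun x i => ∑ k, x k (i k)
        map_add' := fun x y => by ext i; simp [Finset.sum_add_distrib]
        map_smul' := fun r x => by ext i; simp [Finset.mul_sum] }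
    obtain ⟨x, hx⟩ := exists_sum_mul_exp_eq_of_nonneg L hA hB hAB
    refine ⟨fun i => Real.exp (∑ k, x k (i k)) * B i,
      fun i => mul_nonneg (Real.exp_pos _).le (hB i), ⟨x, fun i => rfl⟩, fun k ik => ?_⟩
    have hL : ∀ i, L (Pi.single k (Pi.single ik 1)) i = if i k = ik then 1 else 0 := fun i => by
      change ∑ l, (Pi.single k (Pi.single ik 1) : (k : Fin d) → Fin (m k) → ℝ) l (i l) = _
      rw [Finset.sum_eq_single k (fun l _ hl => by simp [Pi.single_eq_of_ne hl]) (by simp)]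
      simp [Pi.single_apply]
    have hpair := hx (Pi.single k (Pi.single ik 1))
    simp only [hL, mul_ite, mul_one, mul_zero, ← Finset.sum_filter] at hpair
    rw [← hsum k ik, ← hpair]
    exact Finset.sum_congr rfl fun i _ => mul_comm _ _
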